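/- There is an absolute constant C such that the following holds. Let A be a normal-form udpda with state set Q and initial state q0, and suppose the transcript of the unique infinite computation of A starting at (q0,⊥) is infinite. Then there exists a pair (T',T'') of SLPs over {a,f} of total size at most C·|Q| such that str(T')·str(T'')^ω equals this transcript. -/

import Mathlib

/-- The auxiliary alphabet `{a, f}` used in transcripts of computations. -/
inductive AF
  | a
  | f
deriving DecidableEq

/-- A straight-line program in Chomsky normal form over alphabet `α`:
nonterminals are `Fin n`, each production is either a terminal or a pair of
nonterminals with strictly smaller indices (this index condition is a
topological ordering witnessing acyclicity of the SLP).  The size of such an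
SLP is its number `n` of nonterminals. -/
structure CnfSLP (α : Type) where
  n : ℕ
  ax : Fin n
  prod : Fin n → α ⊕ (Fin n × Fin n)
  wf : ∀ (i B C : Fin n), prod i = Sum.inr (B, C) → B < i ∧ C < i

namespace CnfSLP

variable {α : Type}

/-- The word generated by nonterminal `i`. -/
def strAt (P : CnfSLP α) : Fin P.n → List α
  | i =>
    match h : P.prod i with
    | Sum.inl a => [a]
    | Sum.inr (B, C) => P.strAt B ++ P.strAt C
termination_by i => i.val
decreasing_by
  · exact (P.wf i B C h).1
  · exact (P.wf i B C h).2

/-- The word generated by the SLP (from its axiom). -/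
def str (P : CnfSLP α) : List α := P.strAt P.ax

/-- The size of an SLP: the number of nonterminals (in Chomsky normal form). -/
def size (P : CnfSLP α) : ℕ := P.n

end CnfSLP

/-- `Generates u w c` means the infinite sequence `u · w^ω` is well defined
(`w` is nonempty) and equals the sequence `c`. -/
def Generates {α : Type} (u w : List α) (c : ℕ → α) : Prop :=
  w ≠ [] ∧ ∀ i : ℕ,
    (if i < u.length then u[i]? else w[(i - u.length) % w.length]?) = some (c i)

/-- The kind of a control state of a normal-form udpda: internal, push, or pop. -/
inductive StKind
  | internal
  | push
  | pop
deriving DecidableEq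

/-- A normal-form udpda: the state set is partitioned (by `kind`) into internal
states `Q₀`, push states `Q₊₁` and pop states `Q₋₁`, with total transition
functions `δint`, `δpush`, `δpop`, and `reads q = true` iff the transitions
from `q` read the input symbol `a` (i.e. `q ∈ R`). -/
structure NFPDA (Q Γ : Type) where
  finQ : Finite Q
  finΓ : Finite Γ
  bot : Γ
  init : Q
  final : Set Q
  kind : Q → StKind
  δint : Q → Q
  δpush : Q → Q × Γ
  δpop : Q → Γ → Q
  reads : Q → Bool

namespace NFPDA

variable {Q Γ : Type}

/-- Valid stack contents: a word in `(Γ∖{⊥})*⊥`. -/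
def IsStack (A : NFPDA Q Γ) (s : List Γ) : Prop :=
  ∃ s', A.bot ∉ s' ∧ s = s' ++ [A.bot]

/-- The unique move available at a configuration.  (A pop transition with the
bottom symbol on top of the stack leaves the stack unchanged; on valid stacks
the bottom symbol is on top exactly when the stack is a singleton.) -/
def step (A : NFPDA Q Γ) : Q × List Γ → Q × List Γ := fun c =>
  match A.kind c.1 with
  | .internal => (A.δint c.1, c.2)
  | .push => ((A.δpush c.1).1, (A.δpush c.1).2 :: c.2)
  | .pop =>
    match c.2 with
    | [] => (c.1, [])
    | [γ] => (A.δpop c.1 γ, [γ])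
    | γ :: s' => (A.δpop c.1 γ, s')

/-- The configuration reached after `k` moves of the unique infinite
computation starting at `c`. -/
def iter (A : NFPDA Q Γ) (c : Q × List Γ) (k : ℕ) : Q × List Γ := A.step^[k] c

open Classical in
/-- The contribution `μ(q)σ` of one move from state `q` to the transcript:
`f` if `q` is final, followed by `a` if the move reads an input symbol. -/
noncomputable def emit (A : NFPDA Q Γ) (q : Q) : List AF :=
  (if q ∈ A.final then [AF.f] else []) ++ (if A.reads q then [AF.a] else [])

/-- The transcript `μ(q₁)σ₁μ(q₂)σ₂⋯μ(q_k)σ_k` of the first `k` moves of the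
computation starting at `c`. -/
noncomputable def transcriptN (A : NFPDA Q Γ) (c : Q × List Γ) (k : ℕ) : List AF :=
  ((List.range k).map fun i => A.emit (A.iter c i).1).flatten

/-- The number of input symbols read during the first `k` moves of the
computation starting at `c`. -/
def readCount (A : NFPDA Q Γ) (c : Q × List Γ) (k : ℕ) : ℕ :=
  ((List.range k).filter fun i => A.reads (A.iter c i).1).length

/-- The language of a normal-form udpda: `a^n` is accepted iff the unique
computation starting at `(q₀, ⊥)` reaches a final state having read exactly
`n` input symbols. -/
def lang (A : NFPDA Q Γ) : Set ℕ :=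
  {n | ∃ k, A.readCount (A.init, [A.bot]) k = n ∧ (A.iter (A.init, [A.bot]) k).1 ∈ A.final}

end NFPDA


/-! ### Straight-line chains of words -/

/-- A list of words (latest first) each of which is a letter or a concatenation of earlier ones. -/
inductive SLChain {α : Type} : List (List α) → Prop
  | nil : SLChain []
  | letter {L : List (List α)} (a : α) : SLChain L → SLChain ([a] :: L)
  | cat {L : List (List α)} {u v : List α} : SLChain L → u ∈ L → v ∈ L → SLChain ((u ++ v) :: L)

theorem exists_slp_of_fun {α : Type} (n : ℕ) (w : Fin n → List α)
    (hw : ∀ i, (∃ a, w i = [a]) ∨ ∃ B C, B < i ∧ C < i ∧ w i = w B ++ w C) (ax : Fin n) :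
    ∃ P : CnfSLP α, P.size = n ∧ P.str = w ax := by
  classical
  have key : ∀ i, ∃ p : α ⊕ (Fin n × Fin n), (∀ a, p = Sum.inl a → w i = [a]) ∧
      (∀ B C, p = Sum.inr (B, C) → B < i ∧ C < i ∧ w i = w B ++ w C) := by
    intro i
    rcases hw i with ⟨a, ha⟩ | ⟨B, C, h1, h2, h3⟩
    · refine ⟨Sum.inl a, ?_, ?_⟩
      · intro b hb
        cases hb
        exact ha
      · intro B C h
        cases h
    · refine ⟨Sum.inr (B, C), ?_, ?_⟩
      · intro b hb
        cases hb
      · intro B' C' h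
        cases h
        exact ⟨h1, h2, h3⟩
  choose p hp1 hp2 using key
  let P : CnfSLP α := ⟨n, ax, p, fun i B C h => ⟨(hp2 i B C h).1, (hp2 i B C h).2.1⟩⟩
  have main : ∀ m : ℕ, ∀ i : Fin n, i.val = m → P.strAt i = w i := by
    intro m
    induction m using Nat.strong_induction_on with
    | _ m ih =>
      intro i hi
      rw [CnfSLP.strAt]
      split
      · rename_i a h
        exact (hp1 i a h).symm
      · rename_i B C h
        obtain ⟨h1, h2, h3⟩ := hp2 i B C h
        rw [ih B.val (by rw [← hi]; exact h1) B rfl, ih C.val (by rw [← hi]; exact h2) C rfl]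
        exact h3.symm
  exact ⟨P, rfl, main _ ax rfl⟩

theorem SLChain.get {α : Type} {L : List (List α)} (h : SLChain L) :
    ∀ i (hi : i < L.length), (∃ a, L[i] = [a]) ∨
      ∃ (B C : ℕ) (hB : B < L.length) (hC : C < L.length), i < B ∧ i < C ∧ L[i] = L[B] ++ L[C] := by
  induction h with
  | nil => intro i hi; simp at hi
  | letter a _ ih =>
    intro i hi
    cases i with
    | zero => left; exact ⟨a, rfl⟩
    | succ i =>
      rcases ih i (by simpa using hi) with ⟨b, hb⟩ | ⟨B, C, hB, hC, h1, h2, h3⟩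
      · left; exact ⟨b, by simpa using hb⟩
      · right
        exact ⟨B + 1, C + 1, by simpa using hB, by simpa using hC, by omega, by omega,
          by simpa using h3⟩
  | cat _ hu hv ih =>
    intro i hi
    cases i with
    | zero =>
      right
      obtain ⟨B, hB, hB'⟩ := List.getElem_of_mem hu
      obtain ⟨C, hC, hC'⟩ := List.getElem_of_mem hv
      exact ⟨B + 1, C + 1, by simpa using hB, by simpa using hC, by omega, by omega,
          by simp [hB', hC']⟩
    | succ i =>
      rcases ih i (by simpa using hi) with ⟨b, hb⟩ | ⟨B, C, hB, hC, h1, h2, h3⟩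
      · left; exact ⟨b, by simpa using hb⟩
      · right
        exact ⟨B + 1, C + 1, by simpa using hB, by simpa using hC, by omega, by omega,
          by simpa using h3⟩

theorem SLChain.exists_slp {α : Type} {L : List (List α)} (h : SLChain L) {w : List α}
    (hw : w ∈ L) : ∃ P : CnfSLP α, P.size = L.length ∧ P.str = w := by
  obtain ⟨x, hx, hx'⟩ := List.getElem_of_mem hw
  obtain ⟨P, h1, h2⟩ := exists_slp_of_fun L.length
    (fun i => L[L.length - 1 - i.val]'(by have := i.2; omega)) (by
      intro i
      have hi := i.2
      rcases h.get (L.length - 1 - i.val) (by omega) with ⟨a, ha⟩ | ⟨B, C, hB, hC, h1, h2, h3⟩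
      · left; exact ⟨a, ha⟩
      · right
        refine ⟨⟨L.length - 1 - B, by omega⟩, ⟨L.length - 1 - C, by omega⟩, ?_, ?_, ?_⟩
        · rw [Fin.lt_def]; simp only; omega
        · rw [Fin.lt_def]; simp only; omega
        · have e1 : L.length - 1 - (L.length - 1 - B) = B := by omega
          have e2 : L.length - 1 - (L.length - 1 - C) = C := by omega
          simp only [e1, e2]
          exact h3) ⟨L.length - 1 - x, by omega⟩
  refine ⟨P, h1, h2.trans ?_⟩
  have e1 : L.length - 1 - (L.length - 1 - x) = x := by omega
  simp only [e1]
  exact hx'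

/-- The set `S` of words can be generated with at most `n` nonterminals (ignoring `ε`). -/
def Comp {α : Type} (S : Set (List α)) (n : ℕ) : Prop :=
  ∃ L, SLChain L ∧ L.length ≤ n ∧ ∀ w ∈ S, w = [] ∨ w ∈ L

theorem Comp.mono {α : Type} {S S' : Set (List α)} {n n' : ℕ} (h : Comp S n) (hS : S' ⊆ S)
    (hn : n ≤ n') : Comp S' n' := by
  obtain ⟨L, h1, h2, h3⟩ := h
  exact ⟨L, h1, h2.trans hn, fun w hw => h3 w (hS hw)⟩

theorem Comp.append {α : Type} {S : Set (List α)} {n : ℕ} (h : Comp S n) {u v : List α}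
    (hu : u ∈ S) (hv : v ∈ S) : Comp (insert (u ++ v) S) (n + 1) := by
  obtain ⟨L, h1, h2, h3⟩ := h
  by_cases hu0 : u = []
  · refine ⟨L, h1, by omega, ?_⟩
    rintro w (hw | hw)
    · rw [hw, hu0]
      exact h3 v hv
    · exact h3 w hw
  by_cases hv0 : v = []
  · refine ⟨L, h1, by omega, ?_⟩
    rintro w (hw | hw)
    · rw [hw, hv0, List.append_nil]
      exact h3 u hu
    · exact h3 w hw
  have hu' := (h3 u hu).resolve_left hu0
  have hv' := (h3 v hv).resolve_left hv0
  refine ⟨(u ++ v) :: L, h1.cat hu' hv', by simpa using h2, ?_⟩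
  rintro w (rfl | hw)
  · right; simp
  · rcases h3 w hw with h | h
    · left; exact h
    · right; exact List.mem_cons_of_mem _ h

theorem Comp.insert_nil {α : Type} {S : Set (List α)} {n : ℕ} (h : Comp S n) :
    Comp (insert [] S) n := by
  obtain ⟨L, h1, h2, h3⟩ := h
  refine ⟨L, h1, h2, ?_⟩
  rintro w (rfl | hw)
  · left; rfl
  · exact h3 w hw

/-- `w` is a concatenation of at most `m` words from `S`. -/
def IsCat {α : Type} (S : Set (List α)) (m : ℕ) (w : List α) : Prop :=
  ∃ ws : List (List α), ws.length ≤ m ∧ (∀ x ∈ ws, x ∈ S) ∧ ws.flatten = w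

theorem IsCat.of_mem {α : Type} {S : Set (List α)} {w : List α} (h : w ∈ S) : IsCat S 1 w :=
  ⟨[w], by simp, by simpa using h, by simp⟩

theorem IsCat.append {α : Type} {S : Set (List α)} {m n : ℕ} {u v : List α} (hu : IsCat S m u)
    (hv : IsCat S n v) : IsCat S (m + n) (u ++ v) := by
  obtain ⟨us, h1, h2, rfl⟩ := hu
  obtain ⟨vs, h4, h5, rfl⟩ := hv
  refine ⟨us ++ vs, by simp; omega, ?_, by simp⟩
  intro x hx
  rcases List.mem_append.1 hx with h | h
  · exact h2 x h
  · exact h5 x h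

theorem IsCat.mono {α : Type} {S : Set (List α)} {m n : ℕ} {u : List α} (hu : IsCat S m u)
    (h : m ≤ n) : IsCat S n u := by
  obtain ⟨us, h1, h2, h3⟩ := hu
  exact ⟨us, h1.trans h, h2, h3⟩

theorem Comp.cat {α : Type} {S : Set (List α)} {n m : ℕ} (h : Comp S n) {w : List α}
    (hw : IsCat S m w) : Comp (insert w S) (n + m) := by
  obtain ⟨ws, h1, h2, rfl⟩ := hw
  have : Comp (insert ws.flatten S) (n + ws.length) := by
    clear h1
    induction ws with
    | nil => simpa using h.insert_nil
    | cons x ws ih =>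
      have := (ih (fun y hy => h2 y (List.mem_cons_of_mem _ hy))).append
        (Set.mem_insert_of_mem _ (h2 x (by simp))) (Set.mem_insert _ _)
      refine this.mono ?_ (by simp only [List.length_cons]; omega)
      rintro w (rfl | hw)
      · left; simp
      · right; right; exact hw
  exact this.mono subset_rfl (by omega)

theorem Comp.exists_slp {α : Type} {S : Set (List α)} {n : ℕ} (h : Comp S n) {w : List α}
    (hw : w ∈ S) (hne : w ≠ []) : ∃ P : CnfSLP α, P.size ≤ n ∧ P.str = w := by
  obtain ⟨L, h1, h2, h3⟩ := h
  obtain ⟨P, h4, h5⟩ := h1.exists_slp ((h3 w hw).resolve_left hne)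
  exact ⟨P, by omega, h5⟩

/-! ### Returning computations -/

namespace NFPDA

variable {Q Γ : Type}

/-- `Run c k w c'`: in `k` moves, `c` goes to `c'` with transcript `w`. -/
def Run (A : NFPDA Q Γ) (c : Q × List Γ) (k : ℕ) (w : List AF) (c' : Q × List Γ) : Prop :=
  A.iter c k = c' ∧ A.transcriptN c k = w

theorem iter_add (A : NFPDA Q Γ) (c : Q × List Γ) (k l : ℕ) :
    A.iter c (k + l) = A.iter (A.iter c k) l := by
  unfold iter
  rw [Nat.add_comm, Function.iterate_add_apply]

theorem transcriptN_add (A : NFPDA Q Γ) (c : Q × List Γ) (k l : ℕ) :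
    A.transcriptN c (k + l) = A.transcriptN c k ++ A.transcriptN (A.iter c k) l := by
  unfold transcriptN
  rw [List.range_add, List.map_append, List.flatten_append, List.map_map]
  simp only [Function.comp_def, iter_add]

theorem Run.refl (A : NFPDA Q Γ) (c : Q × List Γ) : A.Run c 0 [] c := ⟨rfl, rfl⟩

theorem Run.one (A : NFPDA Q Γ) {c c' : Q × List Γ} (h : A.step c = c') :
    A.Run c 1 (A.emit c.1) c' := ⟨h, by simp [transcriptN, iter]⟩

theorem Run.trans {A : NFPDA Q Γ} {c c' c'' : Q × List Γ} {k l : ℕ} {w v : List AF}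
    (h : A.Run c k w c') (h' : A.Run c' l v c'') : A.Run c (k + l) (w ++ v) c'' := by
  obtain ⟨rfl, rfl⟩ := h
  obtain ⟨rfl, rfl⟩ := h'
  exact ⟨A.iter_add _ _ _, A.transcriptN_add _ _ _⟩

/-- `Ret q e w`: started in `q`, the computation first wants to pop below its initial stack in
state `e`, having produced the transcript `w` before that pop. -/
inductive Ret (A : NFPDA Q Γ) : Q → Q → List AF → Prop
  | pop {q : Q} : A.kind q = .pop → Ret A q q []
  | int {q e : Q} {w : List AF} : A.kind q = .internal → Ret A (A.δint q) e w →
      Ret A q e (A.emit q ++ w)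
  | push {q e e' : Q} {w w' : List AF} : A.kind q = .push → Ret A (A.δpush q).1 e' w' →
      Ret A (A.δpop e' (A.δpush q).2) e w →
      Ret A q e (A.emit q ++ (w' ++ (A.emit e' ++ w)))

theorem step_int (A : NFPDA Q Γ) {q : Q} (h : A.kind q = .internal) (s : List Γ) :
    A.step (q, s) = (A.δint q, s) := by simp [step, h]

theorem step_push (A : NFPDA Q Γ) {q : Q} (h : A.kind q = .push) (s : List Γ) :
    A.step (q, s) = ((A.δpush q).1, (A.δpush q).2 :: s) := by simp [step, h]

theorem step_pop (A : NFPDA Q Γ) {q : Q} (h : A.kind q = .pop) (g : Γ) {s : List Γ}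
    (hs : s ≠ []) : A.step (q, g :: s) = (A.δpop q g, s) := by
  cases s with
  | nil => exact absurd rfl hs
  | cons x s => simp [step, h]

theorem step_pop_single (A : NFPDA Q Γ) {q : Q} (h : A.kind q = .pop) (g : Γ) :
    A.step (q, [g]) = (A.δpop q g, [g]) := by simp [step, h]

theorem Ret.kind {A : NFPDA Q Γ} {q e : Q} {w : List AF} (h : A.Ret q e w) :
    A.kind e = .pop := by
  induction h with
  | pop h => exact h
  | int _ _ ih => exact ih
  | push _ _ _ _ ih => exact ih

theorem Ret.run {A : NFPDA Q Γ} {q e : Q} {w : List AF} (h : A.Ret q e w) :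
    ∀ s : List Γ, s ≠ [] → ∃ k, A.Run (q, s) k w (e, s) := by
  induction h with
  | pop h => intro s _; exact ⟨0, Run.refl _ _⟩
  | int h _ ih =>
    intro s hs
    obtain ⟨k, hk⟩ := ih s hs
    exact ⟨1 + k, (Run.one A (A.step_int h s)).trans hk⟩
  | push h h1 _ ih1 ih2 =>
    intro s hs
    obtain ⟨k, hk⟩ := ih1 (_ :: s) (List.cons_ne_nil _ _)
    obtain ⟨l, hl⟩ := ih2 s hs
    exact ⟨_, (Run.one A (A.step_push h s)).trans
      (hk.trans ((Run.one A (A.step_pop h1.kind _ hs)).trans hl))⟩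

theorem Ret.det {A : NFPDA Q Γ} {q e : Q} {w : List AF} (h : A.Ret q e w) :
    ∀ {e' : Q} {w' : List AF}, A.Ret q e' w' → e = e' ∧ w = w' := by
  induction h with
  | pop h =>
    intro e' w' h'
    cases h' with
    | pop _ => exact ⟨rfl, rfl⟩
    | int h2 => rw [h] at h2; cases h2
    | push h2 => rw [h] at h2; cases h2
  | int h _ ih =>
    intro e' w' h'
    cases h' with
    | pop h2 => rw [h] at h2; cases h2
    | int _ h3 =>
      obtain ⟨rfl, rfl⟩ := ih h3
      exact ⟨rfl, rfl⟩
    | push h2 => rw [h] at h2; cases h2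
  | push h _ _ ih1 ih2 =>
    intro e' w' h'
    cases h' with
    | pop h2 => rw [h] at h2; cases h2
    | int h2 => rw [h] at h2; cases h2
    | push _ h3 h4 =>
      obtain ⟨rfl, rfl⟩ := ih1 h3
      obtain ⟨rfl, rfl⟩ := ih2 h4
      exact ⟨rfl, rfl⟩

/-- Words available: `ε`, the letters, `fa`, and the transcripts of returns from states in `F`. -/
def words (A : NFPDA Q Γ) (F : Set Q) : Set (List AF) :=
  {w | w = [] ∨ w = [AF.f] ∨ w = [AF.a] ∨ w = [AF.f, AF.a] ∨ ∃ q ∈ F, ∃ e, A.Ret q e w}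

theorem emit_mem (A : NFPDA Q Γ) (F : Set Q) (q : Q) : A.emit q ∈ A.words F := by
  unfold emit words
  by_cases h1 : q ∈ A.final <;> by_cases h2 : A.reads q <;> simp [h1, h2]

theorem comp_base (A : NFPDA Q Γ) : Comp (A.words ∅) 3 := by
  refine ⟨[[AF.f, AF.a], [AF.f], [AF.a]], ?_, by simp, ?_⟩
  · exact ((SLChain.nil.letter AF.a).letter AF.f).cat (u := [AF.f]) (v := [AF.a])
      (by simp) (by simp)
  · rintro w (h | h | h | h | ⟨q, hq, _⟩)
    · simp [h]
    · simp [h]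
    · simp [h]
    · simp [h]
    · exact absurd hq (by simp)

theorem comp_words (A : NFPDA Q Γ) : Comp (A.words Set.univ) (3 + 4 * Nat.card Q) := by
  classical
  haveI := A.finQ
  letI := Fintype.ofFinite Q
  let good : Finset (Finset Q) :=
    Finset.univ.filter fun F => Comp (A.words (F : Set Q)) (3 + 4 * F.card)
  have hne : good.Nonempty := ⟨∅, by
    simp only [good, Finset.mem_filter, Finset.mem_univ, true_and]
    simpa using A.comp_base⟩
  obtain ⟨F, hF, hmax⟩ := Finset.exists_max_image good Finset.card hne
  have hF' : Comp (A.words (F : Set Q)) (3 + 4 * F.card) := (Finset.mem_filter.1 hF).2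
  have add : ∀ q e w, A.Ret q e w → IsCat (A.words (F : Set Q)) 4 w →
      w ∈ A.words (F : Set Q) := by
    intro q e w hr hc
    by_cases hq : q ∈ F
    · right; right; right; right
      exact ⟨q, hq, e, hr⟩
    · exfalso
      have h1 : insert q F ∈ good := by
        simp only [good, Finset.mem_filter, Finset.mem_univ, true_and]
        refine (hF'.cat hc).mono ?_ (by rw [Finset.card_insert_of_notMem hq]; omega)
        rintro v (h | h | h | h | ⟨p, hp, e', hr'⟩)
        · right; left; exact h
        · right; right; left; exact h
        · right; right; right; left; exact h
        · right; right; right; right; left; exact h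
        · rw [Finset.coe_insert] at hp
          rcases hp with rfl | hp
          · left; exact (hr'.det hr).2
          · right; right; right; right; right; exact ⟨p, hp, e', hr'⟩
      have := hmax _ h1
      rw [Finset.card_insert_of_notMem hq] at this
      omega
  have all : ∀ q e w, A.Ret q e w → w ∈ A.words (F : Set Q) := by
    intro q e w hr
    induction hr with
    | pop _ => left; rfl
    | int h h1 ih =>
      exact add _ _ _ (Ret.int h h1)
        (((IsCat.of_mem (A.emit_mem _ _)).append (IsCat.of_mem ih)).mono (by omega))
    | push h h1 h2 ih1 ih2 =>
      exact add _ _ _ (Ret.push h h1 h2)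
        (((IsCat.of_mem (A.emit_mem _ _)).append ((IsCat.of_mem ih1).append
          ((IsCat.of_mem (A.emit_mem _ _)).append (IsCat.of_mem ih2)))).mono (by omega))
  refine hF'.mono ?_ ?_
  · rintro v (h | h | h | h | ⟨p, hp, e', hr'⟩)
    · left; exact h
    · right; left; exact h
    · right; right; left; exact h
    · right; right; right; left; exact h
    · exact all _ _ _ hr'
  · have := Finset.card_le_univ F
    rw [Nat.card_eq_fintype_card]
    omega

/-! ### Macro steps -/

/-- Macro states: a state with a flag telling whether we are strictly above the bottom, in which
case the computation never returns below the current level. -/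
def Macro (A : NFPDA Q Γ) : Type := {m : Q × Bool // m.2 = true → ¬ ∃ e w, A.Ret m.1 e w}

/-- The configurations represented by a macro state. -/
def Rep (A : NFPDA Q Γ) (m : A.Macro) (c : Q × List Γ) : Prop :=
  c.1 = m.1.1 ∧ c.2 ≠ [] ∧ (m.1.2 = false → c.2 = [A.bot])

theorem macro_step (A : NFPDA Q Γ) (m : A.Macro) : ∃ (m' : A.Macro) (w : List AF),
    IsCat (A.words Set.univ) 3 w ∧
    ∀ c, A.Rep m c → ∃ k c', 0 < k ∧ A.Run c k w c' ∧ A.Rep m' c' := by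
  obtain ⟨⟨q, b⟩, hm⟩ := m
  cases hk : A.kind q with
  | internal =>
    refine ⟨⟨(A.δint q, b), ?_⟩, A.emit q, (IsCat.of_mem (A.emit_mem _ _)).mono (by omega), ?_⟩
    · rintro hb ⟨e, w, hr⟩
      exact hm hb ⟨_, _, Ret.int hk hr⟩
    · rintro ⟨p, s⟩ ⟨h1, h2, h3⟩
      obtain rfl : p = q := h1
      exact ⟨1, _, one_pos, Run.one A (A.step_int hk s), rfl, h2, h3⟩
  | pop =>
    cases b with
    | true => exact absurd ⟨_, _, Ret.pop hk⟩ (hm rfl)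
    | false =>
      refine ⟨⟨(A.δpop q A.bot, false), ?_⟩, A.emit q,
        (IsCat.of_mem (A.emit_mem _ _)).mono (by omega), ?_⟩
      · intro hb; cases hb
      · rintro ⟨p, s⟩ ⟨h1, h2, h3⟩
        obtain rfl : p = q := h1
        obtain rfl : s = [A.bot] := h3 rfl
        exact ⟨1, _, one_pos, Run.one A (A.step_pop_single hk _), rfl, h2, h3⟩
  | push =>
    by_cases hr : ∃ e w, A.Ret (A.δpush q).1 e w
    · obtain ⟨e, w, hr⟩ := hr
      refine ⟨⟨(A.δpop e (A.δpush q).2, b), ?_⟩, A.emit q ++ (w ++ A.emit e), ?_, ?_⟩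
      · rintro hb ⟨e', w', hr'⟩
        exact hm hb ⟨_, _, Ret.push hk hr hr'⟩
      · exact ((IsCat.of_mem (A.emit_mem _ _)).append ((IsCat.of_mem (Or.inr (Or.inr (Or.inr
          (Or.inr ⟨_, Set.mem_univ _, _, hr⟩))))).append
          (IsCat.of_mem (A.emit_mem _ _)))).mono (by omega)
      · rintro ⟨p, s⟩ ⟨h1, h2, h3⟩
        obtain rfl : p = q := h1
        obtain ⟨k, hk'⟩ := hr.run ((A.δpush p).2 :: s) (List.cons_ne_nil _ _)
        exact ⟨1 + (k + 1), _, by omega, (Run.one A (A.step_push hk s)).trans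
          (hk'.trans (Run.one A (A.step_pop hr.kind _ h2))), rfl, h2, h3⟩
    · refine ⟨⟨((A.δpush q).1, true), fun _ => hr⟩, A.emit q,
        (IsCat.of_mem (A.emit_mem _ _)).mono (by omega), ?_⟩
      rintro ⟨p, s⟩ ⟨h1, h2, h3⟩
      obtain rfl : p = q := h1
      refine ⟨1, _, one_pos, Run.one A (A.step_push hk s), rfl, List.cons_ne_nil _ _, ?_⟩
      intro hb; cases hb

end NFPDA

/-! ### Eventually periodic outputs -/

/-- Concatenated output of `n` macro steps from `m`. -/
def outs {M α : Type} (nx : M → M) (o : M → List α) : M → ℕ → List α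
  | _, 0 => []
  | m, n + 1 => o m ++ outs nx o (nx m) n

theorem outs_add {M α : Type} (nx : M → M) (o : M → List α) (n k : ℕ) : ∀ m,
    outs nx o m (n + k) = outs nx o m n ++ outs nx o (nx^[n] m) k := by
  induction n with
  | zero => intro m; simp [outs]
  | succ n ih =>
    intro m
    rw [Nat.add_right_comm]
    simp [outs, ih]

theorem outs_cat {M α : Type} (nx : M → M) (o : M → List α) {S : Set (List α)} {d : ℕ}
    (h : ∀ m, IsCat S d (o m)) (n : ℕ) : ∀ m, IsCat S (d * n) (outs nx o m n) := by
  induction n with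
  | zero => intro m; exact ⟨[], by simp, by simp, rfl⟩
  | succ n ih =>
    intro m
    exact ((h m).append (ih (nx m))).mono (by rw [Nat.mul_succ]; omega)

theorem outs_periodic {M α : Type} (nx : M → M) (o : M → List α) (m : M) (p : ℕ)
    (h : nx^[p] m = m) (n : ℕ) :
    outs nx o m (n * p) = (List.replicate n (outs nx o m p)).flatten := by
  induction n with
  | zero => simp [outs]
  | succ n ih =>
    rw [Nat.succ_mul, Nat.add_comm, outs_add, h, ih]
    simp [List.replicate_succ]

theorem replicate_getElem? {α : Type} (w : List α) (n : ℕ) : ∀ x, x < n * w.length →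
    (List.replicate n w).flatten[x]? = w[x % w.length]? := by
  induction n with
  | zero => intro x hx; simp at hx
  | succ n ih =>
    intro x hx
    rw [List.replicate_succ, List.flatten_cons]
    by_cases h : x < w.length
    · rw [List.getElem?_append_left h, Nat.mod_eq_of_lt h]
    · push Not at h
      rw [List.getElem?_append_right h, ih _ (by rw [Nat.succ_mul] at hx; omega),
        Nat.mod_eq_sub_mod h]

/-- There is an absolute constant `C` such that for every
normal-form udpda `A` with state set `Q` and initial state `q₀` whose
transcript of the unique infinite computation starting at `(q₀,⊥)` is
infinite (i.e. the finite transcripts grow unboundedly), and for the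
infinite transcript `t` (characterized by having every finite transcript as
a prefix), there is a pair `(T1, T2)` of SLPs over `{a,f}` of total size at
most `C·|Q|` with `str(T1)·str(T2)^ω = t`. -/
theorem udpda_transcript_slp :
    ∃ C : ℕ, ∀ (Q Γ : Type) (A : NFPDA Q Γ) (t : ℕ → AF),
      (∀ n : ℕ, ∃ k, n ≤ (A.transcriptN (A.init, [A.bot]) k).length) →
      (∀ (k i : ℕ) (h : i < (A.transcriptN (A.init, [A.bot]) k).length),
        (A.transcriptN (A.init, [A.bot]) k)[i] = t i) →
      ∃ T1 T2 : CnfSLP AF,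
        T1.size + T2.size ≤ C * Nat.card Q ∧ Generates T1.str T2.str t := by
  refine ⟨38, ?_⟩
  intro Q Γ A t hinf ht
  classical
  haveI := A.finQ
  haveI : Nonempty Q := ⟨A.init⟩
  have hQ : 0 < Nat.card Q := Nat.card_pos
  choose nx o hcat hstep using A.macro_step
  let m0 : A.Macro := ⟨(A.init, false), by intro h; cases h⟩
  have h0 : A.Rep m0 (A.init, [A.bot]) := ⟨rfl, List.cons_ne_nil _ _, fun _ => rfl⟩
  have hrun : ∀ n m c, A.Rep m c → ∃ k c', n ≤ k ∧ A.Run c k (outs nx o m n) c' := by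
    intro n
    induction n with
    | zero => intro m c _; exact ⟨0, c, le_rfl, NFPDA.Run.refl _ _⟩
    | succ n ih =>
      intro m c hc
      obtain ⟨k, c', hk, hr, hc'⟩ := hstep m c hc
      obtain ⟨l, c'', hl, hr'⟩ := ih _ _ hc'
      exact ⟨k + l, c'', by omega, hr.trans hr'⟩
  haveI : Finite A.Macro := inferInstanceAs (Finite {m : Q × Bool // _})
  have hcard : Nat.card A.Macro ≤ 2 * Nat.card Q := by
    have h1 : Nat.card A.Macro ≤ Nat.card (Q × Bool) :=
      Nat.card_le_card_of_injective (fun m : A.Macro => m.1) Subtype.val_injective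
    rw [Nat.card_prod] at h1
    have h2 : Nat.card Bool = 2 := by simp
    rw [h2] at h1
    omega
  obtain ⟨i, j, hij, hj, hper⟩ : ∃ i j : ℕ, i < j ∧ j ≤ 2 * Nat.card Q ∧
      nx^[i] m0 = nx^[j] m0 := by
    letI := Fintype.ofFinite A.Macro
    obtain ⟨x, y, hxy, he⟩ := Fintype.exists_ne_map_eq_of_card_lt
      (fun x : Fin (2 * Nat.card Q + 1) => nx^[x.val] m0)
      (by rw [Fintype.card_fin, ← Nat.card_eq_fintype_card]; omega)
    have hx := x.2
    have hy := y.2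
    rcases lt_or_gt_of_ne (fun h => hxy (Fin.ext h)) with h | h
    · exact ⟨x, y, h, by omega, he⟩
    · exact ⟨y, x, h, by omega, he.symm⟩
  obtain ⟨p, rfl⟩ := Nat.exists_eq_add_of_lt hij
  set m1 := nx^[i] m0 with hm1
  have hp : nx^[p + 1] m1 = m1 := by
    conv_rhs => rw [hper]
    rw [hm1, ← Function.iterate_add_apply]
    rw [show p + 1 + i = i + p + 1 by omega]
  set u := outs nx o m0 i with hu
  set w := outs nx o m1 (p + 1) with hw
  have hO : ∀ n, outs nx o m0 (i + n * (p + 1)) = u ++ (List.replicate n w).flatten := by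
    intro n
    rw [outs_add, outs_periodic _ _ _ _ hp]
  have hlenO : ∀ n, (u ++ (List.replicate n w).flatten).length = u.length + n * w.length := by
    intro n; simp
  have hwne : w ≠ [] := by
    intro hw0
    obtain ⟨k, hk⟩ := hinf (u.length + 1)
    obtain ⟨K, c', hK, hR⟩ := hrun (i + k * (p + 1)) m0 _ h0
    have hkK : k ≤ K := by nlinarith
    obtain ⟨d, rfl⟩ := Nat.exists_eq_add_of_le hkK
    have h1 := hR.2
    rw [NFPDA.transcriptN_add, hO] at h1
    have h2 := congrArg List.length h1
    rw [hlenO, hw0, List.length_append] at h2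
    simp at h2
    omega
  have hwpos : 0 < w.length := List.length_pos_iff.2 hwne
  have hcomp := A.comp_words
  have huw : outs nx o m0 (i + (p + 1)) = u ++ w := by
    have := hO 1
    simpa using this
  have c1 := hcomp.cat (outs_cat nx o hcat (i + (p + 1)) m0)
  have c2 := hcomp.cat (outs_cat nx o hcat (p + 1) m1)
  rw [huw] at c1
  rw [← hw] at c2
  obtain ⟨T1, s1, e1⟩ := c1.exists_slp (Set.mem_insert _ _) (by simp [hwne])
  obtain ⟨T2, s2, e2⟩ := c2.exists_slp (Set.mem_insert _ _) hwne
  refine ⟨T1, T2, by omega, ?_⟩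
  rw [e1, e2]
  refine ⟨hwne, ?_⟩
  intro x
  obtain ⟨K, c', hK, hR⟩ := hrun (i + (x + 2) * (p + 1)) m0 _ h0
  have h1 := hR.2
  rw [hO] at h1
  have hx : x < (A.transcriptN (A.init, [A.bot]) K).length := by
    rw [h1, hlenO]
    nlinarith
  have h2 := ht K x hx
  have h3 : (A.transcriptN (A.init, [A.bot]) K)[x]? = some (t x) := by
    rw [List.getElem?_eq_getElem hx, h2]
  rw [h1, List.replicate_succ, List.flatten_cons, ← List.append_assoc] at h3
  split
  · rename_i hlt
    rwa [List.getElem?_append_left hlt] at h3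
  · rename_i hlt
    push Not at hlt
    rw [List.getElem?_append_right hlt, replicate_getElem?] at h3
    · exact h3
    · have : x + 1 ≤ (x + 1) * w.length := Nat.le_mul_of_pos_right _ hwpos
      omega
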